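/- Let (u,v) be a pair of C² functions on ℝ² satisfying Δu = u v², Δv = v u², u > 0 and v > 0 everywhere on ℝ², together with the linear growth condition u(x) + v(x) ≤ C(1 + |x|) for all x ∈ ℝ² (for some constant C > 0), and the monotonicity condition ∂u/∂x₂ > 0 everywhere on ℝ². Then ∂v/∂x₂ < 0 everywhere on ℝ². -/

import Mathlib

/-- The Laplacian of `f : ℝ² → ℝ`, as the sum of the second partial derivatives. -/
noncomputable def lapl (f : EuclideanSpace ℝ (Fin 2) → ℝ) (x : EuclideanSpace ℝ (Fin 2)) : ℝ :=
  ∑ i, fderiv ℝ (fun y => fderiv ℝ f y (EuclideanSpace.single i 1)) x (EuclideanSpace.single i 1)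

namespace HalfMono

open MeasureTheory Topology Set

abbrev E2 := EuclideanSpace ℝ (Fin 2)

/-- Partial derivative. -/
noncomputable def pd (i : Fin 2) (f : E2 → ℝ) (x : E2) : ℝ :=
  fderiv ℝ f x (EuclideanSpace.single i 1)

lemma lapl_eq (f : E2 → ℝ) (x : E2) : lapl f x = pd 0 (pd 0 f) x + pd 1 (pd 1 f) x := by
  simp only [lapl, Fin.sum_univ_two]; rfl

lemma pd_contDiff {f : E2 → ℝ} (hf : ContDiff ℝ 2 f) (i : Fin 2) : ContDiff ℝ 1 (pd i f) := by
  unfold pd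
  exact (hf.fderiv_right (m := 1) (by norm_num)).clm_apply contDiff_const

lemma pd_cont {f : E2 → ℝ} (hf : ContDiff ℝ 1 f) (i : Fin 2) : Continuous (pd i f) := by
  unfold pd
  exact (hf.continuous_fderiv (by norm_num)).clm_apply continuous_const

lemma diffAt {f : E2 → ℝ} (hf : ContDiff ℝ 1 f) (x : E2) : DifferentiableAt ℝ f x :=
  hf.differentiable (by norm_num) x

lemma pd_mul {f g : E2 → ℝ} (hf : ContDiff ℝ 1 f) (hg : ContDiff ℝ 1 g) (i : Fin 2) (x : E2) :
    pd i (fun y => f y * g y) x = f x * pd i g x + g x * pd i f x := by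
  unfold pd
  rw [fderiv_fun_mul (diffAt hf x) (diffAt hg x)]
  simp

lemma pd_add {f g : E2 → ℝ} (hf : ContDiff ℝ 1 f) (hg : ContDiff ℝ 1 g) (i : Fin 2) (x : E2) :
    pd i (fun y => f y + g y) x = pd i f x + pd i g x := by
  unfold pd
  rw [fderiv_fun_add (diffAt hf x) (diffAt hg x)]
  simp

lemma pd_comp {f : E2 → ℝ} {g : ℝ → ℝ} {gder : ℝ} {x : E2} (hf : ContDiff ℝ 1 f)
    (hg : HasDerivAt g gder (f x)) (i : Fin 2) :
    pd i (fun y => g (f y)) x = gder * pd i f x := by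
  unfold pd
  have := hg.comp_hasFDerivAt x (diffAt hf x).hasFDerivAt
  have h2 : fderiv ℝ (fun y => g (f y)) x = gder • fderiv ℝ f x := this.fderiv
  rw [h2]; simp

lemma pd_symm {f : E2 → ℝ} (hf : ContDiff ℝ 2 f) (i j : Fin 2) (x : E2) :
    pd i (pd j f) x = pd j (pd i f) x := by
  have hd : DifferentiableAt ℝ (fderiv ℝ f) x :=
    (hf.fderiv_right (m := 1) (by norm_num)).differentiable (by norm_num) x
  have key : ∀ a b : Fin 2, pd a (pd b f) x
      = fderiv ℝ (fderiv ℝ f) x (EuclideanSpace.single a 1) (EuclideanSpace.single b 1) := by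
    intro a b
    have h := (hd.hasFDerivAt.clm_apply
      (hasFDerivAt_const (EuclideanSpace.single b (1 : ℝ)) x)).fderiv
    unfold pd
    rw [h]; simp
  rw [key, key]
  exact (hf.contDiffAt.isSymmSndFDerivAt (by simp)) _ _

lemma pd_zero {k : E2 → ℝ} {x : E2} (hx : x ∉ tsupport k) (i : Fin 2) : pd i k x = 0 := by
  unfold pd
  rw [fderiv_of_notMem_tsupport ℝ hx]; simp

lemma k_zero {k : E2 → ℝ} {x : E2} (hx : x ∉ tsupport k) : k x = 0 :=
  image_eq_zero_of_notMem_tsupport hx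

lemma intg {F k : E2 → ℝ} (hF : Continuous F) (hk : HasCompactSupport k)
    (h : ∀ x, x ∉ tsupport k → F x = 0) : Integrable F :=
  hF.integrable_of_hasCompactSupport (HasCompactSupport.intro hk h)

lemma ibp {f k : E2 → ℝ} (hf : ContDiff ℝ 1 f) (hk : ContDiff ℝ 1 k) (hc : HasCompactSupport k)
    (i : Fin 2) : ∫ x, f x * pd i k x = - ∫ x, pd i f x * k x := by
  have c1 := pd_cont hf i
  have c2 := pd_cont hk i
  have c3 := hf.continuous
  have c4 := hk.continuous
  exact integral_mul_fderiv_eq_neg_fderiv_mul_of_integrable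
    (intg (F := fun x => pd i f x * k x) (by fun_prop) hc (fun x hx => by simp [k_zero hx]))
    (intg (F := fun x => f x * pd i k x) (by fun_prop) hc (fun x hx => by simp [pd_zero hx]))
    (intg (by fun_prop) hc (fun x hx => by simp [k_zero hx]))
    (fun x _ => diffAt hf x) (fun x _ => diffAt hk x)

/-- Differentiation under the integral sign along a translation. -/
lemma param_deriv {F k : E2 → ℝ} (hF : ContDiff ℝ 1 F) (hk : Continuous k)
    (hc : HasCompactSupport k) (j : Fin 2) :
    HasDerivAt (fun t : ℝ => ∫ x, F (x + t • EuclideanSpace.single j 1) * k x)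
      (∫ x, pd j F x * k x) 0 := by
  have c1 := pd_cont hF j
  have c2 := hF.continuous
  obtain ⟨M, hM⟩ := ((hc.isCompact.cthickening (r := 1)).exists_bound_of_continuousOn
    (f := pd j F) c1.continuousOn)
  have hzero : ∀ x, x ∉ tsupport k → k x = 0 := fun x hx => k_zero hx
  have := hasDerivAt_integral_of_dominated_loc_of_deriv_le (μ := (volume : Measure E2))
    (F := fun (t : ℝ) x => F (x + t • EuclideanSpace.single j 1) * k x)
    (F' := fun (t : ℝ) x => pd j F (x + t • EuclideanSpace.single j 1) * k x)
    (x₀ := (0 : ℝ)) (bound := fun x => M * |k x|) (s := Metric.ball 0 1)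
    (Metric.ball_mem_nhds _ one_pos)
    (Filter.Eventually.of_forall fun t => by
      have : Continuous fun x => F (x + t • EuclideanSpace.single j 1) * k x := by fun_prop
      exact this.aestronglyMeasurable)
    (intg (by fun_prop) hc (fun x hx => by simp [k_zero hx]))
    (by
      have : Continuous fun x => pd j F (x + (0 : ℝ) • EuclideanSpace.single j 1) * k x := by
        fun_prop
      exact this.aestronglyMeasurable)
    (Filter.Eventually.of_forall fun x t ht => by
      by_cases hx : x ∈ tsupport k
      · rw [norm_mul]
        have : x + t • EuclideanSpace.single j 1 ∈ Metric.cthickening 1 (tsupport k) := by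
          apply Metric.mem_cthickening_of_dist_le _ x _ _ hx
          simp only [dist_self_add_left, norm_smul]
          rw [mem_ball_zero_iff] at ht
          simpa using ht.le
        exact mul_le_mul_of_nonneg_right (hM _ this) (norm_nonneg _)
      · simp [k_zero hx])
    (intg (by fun_prop) hc (fun x hx => by simp [k_zero hx]))
    (Filter.Eventually.of_forall fun x t _ => by
      apply HasDerivAt.mul_const
      have h1 : HasDerivAt (fun t : ℝ => x + t • EuclideanSpace.single j (1 : ℝ))
          (EuclideanSpace.single j (1 : ℝ)) t := by
        simpa using ((hasDerivAt_id t).smul_const (EuclideanSpace.single j (1 : ℝ))).const_add x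
      exact (diffAt hF _).hasFDerivAt.comp_hasDerivAt t h1)
  simpa using this.2

lemma pd_translate (F : E2 → ℝ) (w : E2) (i : Fin 2) (x : E2) :
    pd i (fun y => F (y + w)) x = pd i F (x + w) := by
  unfold pd
  rw [fderiv_comp_add_right]

/-- Weak form of the equation differentiated in direction `x₂`. -/
lemma weak_eq {v f ζ : E2 → ℝ} (hv : ContDiff ℝ 2 v) (hf : ContDiff ℝ 1 f)
    (heq : ∀ x, lapl v x = f x) (hζ : ContDiff ℝ 1 ζ) (hc : HasCompactSupport ζ) :
    (∫ x, pd 0 (pd 1 v) x * pd 0 ζ x) + (∫ x, pd 1 (pd 1 v) x * pd 1 ζ x)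
      = - ∫ x, pd 1 f x * ζ x := by
  have hcp : ∀ i, HasCompactSupport (pd i ζ) := fun i =>
    HasCompactSupport.intro hc (fun x hx => pd_zero hx i)
  have d : ∀ i, HasDerivAt (fun t : ℝ => ∫ x, pd i v (x + t • EuclideanSpace.single 1 1) * pd i ζ x)
      (∫ x, pd 1 (pd i v) x * pd i ζ x) 0 := fun i =>
    param_deriv (pd_contDiff hv i) (pd_cont hζ i) (hcp i) 1
  have df := (param_deriv hf hζ.continuous hc 1).neg
  have e : ∀ t : ℝ, (∫ x, pd 0 v (x + t • EuclideanSpace.single 1 1) * pd 0 ζ x)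
      + (∫ x, pd 1 v (x + t • EuclideanSpace.single 1 1) * pd 1 ζ x)
      = - ∫ x, f (x + t • EuclideanSpace.single 1 1) * ζ x := by
    intro t
    have hs : ∀ i, ContDiff ℝ 1 (fun x => pd i v (x + t • EuclideanSpace.single 1 1)) := fun i =>
      (pd_contDiff hv i).comp (contDiff_id.add contDiff_const)
    rw [ibp (hs 0) hζ hc, ibp (hs 1) hζ hc, ← neg_add, ← integral_add]
    · congr 1
      apply integral_congr_ae
      refine Filter.Eventually.of_forall fun x => ?_
      simp only [pd_translate (pd _ v), ← heq, lapl_eq]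
      ring
    · have := pd_cont (hs 0) 0
      have := hζ.continuous
      exact intg (by fun_prop) hc (fun x hx => by simp [k_zero hx])
    · have := pd_cont (hs 1) 1
      have := hζ.continuous
      exact intg (by fun_prop) hc (fun x hx => by simp [k_zero hx])
  have h2 := ((d 0).add (d 1)).unique (df.congr_of_eventuallyEq
    (Filter.Eventually.of_forall fun t => e t))
  simp only [pd_symm hv 0 1]
  exact h2

lemma int4 {a b c d : E2 → ℝ} (ha : Integrable a) (hb : Integrable b) (hc : Integrable c)
    (hd : Integrable d) : Integrable (fun x => (a x + b x) + (c x + d x)) ∧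
    ∫ x, ((a x + b x) + (c x + d x))
      = ((∫ x, a x) + ∫ x, b x) + ((∫ x, c x) + ∫ x, d x) := by
  have hab : Integrable (fun x => a x + b x) := ha.add hb
  have hcd : Integrable (fun x => c x + d x) := hc.add hd
  exact ⟨hab.add hcd, by rw [integral_add hab hcd, integral_add ha hb, integral_add hc hd]⟩

/-- Caccioppoli. -/
lemma caccioppoli {v η : E2 → ℝ} (hv : ContDiff ℝ 2 v) (hpos : ∀ x, 0 ≤ v x * lapl v x)
    (hη : ContDiff ℝ 1 η) (hc : HasCompactSupport η) :
    ∫ x, (pd 0 v x ^ 2 + pd 1 v x ^ 2) * η x ^ 2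
      ≤ 4 * ∫ x, v x ^ 2 * (pd 0 η x ^ 2 + pd 1 η x ^ 2) := by
  have hv1 : ContDiff ℝ 1 v := hv.of_le (by norm_num)
  have hk : ContDiff ℝ 1 (fun x => η x * (η x * v x)) := hη.mul (hη.mul hv1)
  have hkc : HasCompactSupport (fun x => η x * (η x * v x)) := hc.mul_right
  have i0 := ibp (pd_contDiff hv 0) hk hkc 0
  have i1 := ibp (pd_contDiff hv 1) hk hkc 1
  have c0 := hη.continuous
  have c1 := hv1.continuous
  have c2 := pd_cont hη 0
  have c3 := pd_cont hη 1
  have c4 := pd_cont hv1 0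
  have c5 := pd_cont hv1 1
  have c6 := pd_cont (pd_contDiff hv 0) 0
  have c7 := pd_cont (pd_contDiff hv 1) 1
  have p := fun i x => pd_mul hη (hη.mul hv1) i x
  have q := fun i x => pd_mul hη hv1 i x
  simp only [p, q] at i0 i1
  have I1 : Integrable fun x => (pd 0 v x ^ 2 + pd 1 v x ^ 2) * η x ^ 2 :=
    intg (by fun_prop) hc (fun x hx => by simp [k_zero hx])
  have I2 : Integrable fun x => v x ^ 2 * (pd 0 η x ^ 2 + pd 1 η x ^ 2) :=
    intg (by fun_prop) hc (fun x hx => by simp [pd_zero hx])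
  have J : ∀ i, Integrable fun x => pd i v x * (η x * (η x * pd i v x + v x * pd i η x) + η x * v x * pd i η x) := by
    intro i
    have := pd_cont hη i
    have := pd_cont hv1 i
    exact intg (by fun_prop) hc (fun x hx => by simp [k_zero hx])
  have J2 : ∀ i, Integrable fun x => pd i (pd i v) x * (η x * (η x * v x)) := by
    intro i
    have := pd_cont (pd_contDiff hv i) i
    exact intg (by fun_prop) hc (fun x hx => by simp [k_zero hx])
  have hS : 0 = ∫ x, (pd 0 v x * (η x * (η x * pd 0 v x + v x * pd 0 η x) + η x * v x * pd 0 η x)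
      + pd 1 v x * (η x * (η x * pd 1 v x + v x * pd 1 η x) + η x * v x * pd 1 η x))
      + (pd 0 (pd 0 v) x * (η x * (η x * v x)) + pd 1 (pd 1 v) x * (η x * (η x * v x))) := by
    rw [(int4 (J 0) (J 1) (J2 0) (J2 1)).2, i0, i1]
    ring
  have hle : ∫ x, ((1/2) * ((pd 0 v x ^ 2 + pd 1 v x ^ 2) * η x ^ 2)
      - 2 * (v x ^ 2 * (pd 0 η x ^ 2 + pd 1 η x ^ 2))) ≤ 0 := by
    rw [hS]
    apply integral_mono ((I1.const_mul _).sub (I2.const_mul _))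
      (int4 (J 0) (J 1) (J2 0) (J2 1)).1
    intro x
    have h := mul_nonneg (hpos x) (sq_nonneg (η x))
    rw [lapl_eq] at h
    simp only [Pi.sub_apply]
    nlinarith [sq_nonneg (η x * pd 0 v x + 2 * (v x * pd 0 η x)),
      sq_nonneg (η x * pd 1 v x + 2 * (v x * pd 1 η x))]
  rw [integral_sub (I1.const_mul _) (I2.const_mul _), integral_const_mul, integral_const_mul] at hle
  linarith

/-- squared positive part -/
noncomputable def q (t : ℝ) : ℝ := (max t 0) ^ 2

lemma q_deriv (t : ℝ) : HasDerivAt q (2 * max t 0) t := by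
  rcases lt_trichotomy t 0 with h | h | h
  · rw [max_eq_right h.le, mul_zero]
    apply (hasDerivAt_const t (0 : ℝ)).congr_of_eventuallyEq
    filter_upwards [Iio_mem_nhds h] with s hs
    simp [q, max_eq_right (le_of_lt (by simpa using hs))]
  · subst h
    rw [max_self, mul_zero, hasDerivAt_iff_isLittleO_nhds_zero]
    have : (fun h : ℝ => q (0 + h) - q 0 - h • (0 : ℝ)) =O[𝓝 0] fun h : ℝ => h ^ 2 := by
      apply Asymptotics.IsBigO.of_bound 1
      refine Filter.Eventually.of_forall fun s => ?_
      simp only [q, zero_add, max_self, smul_zero, Real.norm_eq_abs, one_mul]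
      rcases le_total s 0 with hs | hs
      · simp [max_eq_right hs, sq_nonneg]
      · simp [max_eq_left hs]
    exact this.trans_isLittleO (by simpa using (Asymptotics.isLittleO_pow_id (𝕜 := ℝ) one_lt_two))
  · rw [max_eq_left h.le]
    have := hasDerivAt_pow 2 t
    simp at this
    apply this.congr_of_eventuallyEq
    filter_upwards [Ioi_mem_nhds h] with s hs
    simp [q, max_eq_left (le_of_lt (by simpa using hs))]

lemma q_contDiff : ContDiff ℝ 1 q := by
  rw [contDiff_one_iff_deriv]
  refine ⟨fun t => (q_deriv t).differentiableAt, ?_⟩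
  have : deriv q = fun t => 2 * max t 0 := funext fun t => (q_deriv t).deriv
  rw [this]; fun_prop

noncomputable def g (t : ℝ) : ℝ := q t / (1 + t + t ^ 2)

noncomputable def gder (t : ℝ) : ℝ :=
  (2 * max t 0 * (1 + t + t ^ 2) - q t * (1 + 2 * t)) / (1 + t + t ^ 2) ^ 2

lemma den_pos (t : ℝ) : 0 < 1 + t + t ^ 2 := by nlinarith [sq_nonneg (t + 1/2)]

lemma g_deriv (t : ℝ) : HasDerivAt g (gder t) t := by
  have h : HasDerivAt (fun t : ℝ => 1 + t + t ^ 2) (1 + 2 * t) t := by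
    have := ((hasDerivAt_id t).const_add 1).add (hasDerivAt_pow 2 t)
    simp only [Nat.cast_ofNat, Nat.add_one_sub_one, pow_one] at this
    exact this
  exact (q_deriv t).div h (den_pos t).ne'

lemma g_contDiff : ContDiff ℝ 1 g := by
  apply q_contDiff.div (by fun_prop) (fun t => (den_pos t).ne')

lemma gder_cont : Continuous gder := by
  have := q_contDiff.continuous
  unfold gder
  exact Continuous.div (by fun_prop) (by fun_prop) (fun t => (pow_pos (den_pos t) 2).ne')

lemma g_nonneg (t : ℝ) : 0 ≤ g t := div_nonneg (sq_nonneg _) (den_pos t).le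

lemma g_pos {t : ℝ} (h : 0 < t) : 0 < g t := by
  apply div_pos _ (den_pos t)
  simp only [q, max_eq_left h.le]; positivity

lemma g_sq (t : ℝ) : 0 ≤ gder t ∧ g t ^ 2 ≤ t ^ 2 * gder t := by
  rcases le_total t 0 with h | h
  · simp [g, gder, q, max_eq_right h]
  · have hd := den_pos t
    simp only [g, gder, q, max_eq_left h]
    have e : 2 * t * (1 + t + t ^ 2) - t ^ 2 * (1 + 2 * t) = 2 * t + t ^ 2 := by ring
    rw [e]
    refine ⟨by positivity, ?_⟩
    rw [div_pow, ← mul_div_assoc]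
    apply div_le_div_of_nonneg_right _ (by positivity)
    nlinarith [pow_nonneg h 3]

lemma quad (a b e t : ℝ) : 0 ≤ gder t * (a * e) ^ 2 + 2 * g t * (a * e) * b + t ^ 2 * b ^ 2 := by
  obtain ⟨h1, h2⟩ := g_sq t
  rcases h1.eq_or_lt with h | h
  · rw [← h] at h2 ⊢
    have : g t = 0 := by nlinarith
    rw [this]; nlinarith [sq_nonneg (t * b)]
  · have : 0 ≤ gder t * (gder t * (a * e) ^ 2 + 2 * g t * (a * e) * b + t ^ 2 * b ^ 2) := by
      nlinarith [sq_nonneg (gder t * (a * e) + g t * b), mul_nonneg (sub_nonneg.2 h2) (sq_nonneg b)]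
    exact nonneg_of_mul_nonneg_right this h


lemma key1 {u v η : E2 → ℝ} (hu : ContDiff ℝ 2 u) (hv : ContDiff ℝ 2 v)
    (heqv : ∀ x, lapl v x = v x * (u x) ^ 2) (hvpos : ∀ x, 0 < v x)
    (hη : ContDiff ℝ 1 η) (hc : HasCompactSupport η) :
    ∫ x, 2 * u x * v x ^ 2 * pd 1 u x * g (pd 1 v x / v x) * η x ^ 2
      ≤ ∫ x, pd 1 v x ^ 2 * (pd 0 η x ^ 2 + pd 1 η x ^ 2) := by
  have hv1 : ContDiff ℝ 1 v := hv.of_le (by norm_num)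
  have hu1 : ContDiff ℝ 1 u := hu.of_le (by norm_num)
  have hψ := pd_contDiff hv 1
  set ψ := pd 1 v with hψdef
  obtain ⟨τ, hτdef⟩ : ∃ τ : E2 → ℝ, τ = fun x => ψ x / v x := ⟨_, rfl⟩
  have hτ : ContDiff ℝ 1 τ := by
    rw [hτdef]; exact hψ.div hv1 (fun x => (hvpos x).ne')
  have hψτ : ψ = fun x => τ x * v x := by
    ext x; rw [hτdef]; field_simp [(hvpos x).ne']
  have dψ : ∀ i x, pd i ψ x = τ x * pd i v x + v x * pd i τ x := by
    intro i x; conv_lhs => rw [hψτ]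
    exact pd_mul hτ hv1 i x
  have hG : ContDiff ℝ 1 (fun x => g (τ x)) := g_contDiff.comp hτ
  have dG : ∀ i x, pd i (fun x => g (τ x)) x = gder (τ x) * pd i τ x := fun i x =>
    pd_comp hτ (g_deriv _) i
  obtain ⟨H, hHdef⟩ : ∃ H : E2 → ℝ, H = fun x => η x * (η x * g (τ x)) := ⟨_, rfl⟩
  have hH : ContDiff ℝ 1 H := by rw [hHdef]; exact hη.mul (hη.mul hG)
  have hHc : HasCompactSupport H := by rw [hHdef]; exact hc.mul_right
  have dH : ∀ i x, pd i H x = η x * (η x * (gder (τ x) * pd i τ x) + g (τ x) * pd i η x)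
      + η x * g (τ x) * pd i η x := by
    intro i x
    rw [hHdef, pd_mul hη (hη.mul hG), pd_mul hη hG, dG]
  have hf : ContDiff ℝ 1 (fun x => v x * (u x * u x)) := hv1.mul (hu1.mul hu1)
  have df : ∀ x, pd 1 (fun x => v x * (u x * u x)) x
      = v x * (2 * u x * pd 1 u x) + u x ^ 2 * ψ x := by
    intro x
    rw [pd_mul hv1 (hu1.mul hu1), pd_mul hu1 hu1]
    ring
  have W := weak_eq hv hf (fun x => by rw [heqv x]; ring) (ζ := fun x => v x * H x)
    (hv1.mul hH) hHc.mul_left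
  have B : ∀ i, _ := fun i => ibp (hψ.mul (pd_contDiff hv i)) hH hHc i
  simp only [fun i x => pd_mul hv1 hH i x, ← hψdef] at W
  simp only [fun i x => pd_mul hψ (pd_contDiff hv i) i x] at B
  have c0 := hη.continuous
  have c1 := hv1.continuous
  have c2 := hu1.continuous
  have c3 := hψ.continuous
  have c4 := hG.continuous
  have c5 := hH.continuous
  have e1 := fun i => pd_cont hη i
  have e2 := fun i => pd_cont hv1 i
  have e3 := fun i => pd_cont hu1 i
  have e4 := fun i => pd_cont hψ i
  have e5 := fun i => pd_cont hH i
  have e6 := fun i => pd_cont (pd_contDiff hv i) i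
  have e7 := pd_cont hf 1
  have A1 : ∀ i, Integrable fun x => pd i ψ x * (v x * pd i H x + H x * pd i v x) := fun i => by
    have := e2 i; have := e4 i; have := e5 i
    exact intg (by fun_prop) hHc (fun x hx => by simp [k_zero hx, pd_zero hx])
  have A2 : Integrable fun x => pd 1 (fun x => v x * (u x * u x)) x * (v x * H x) :=
    intg (by fun_prop) hHc (fun x hx => by simp [k_zero hx])
  have A3 : ∀ i, Integrable fun x => ψ x * pd i v x * pd i H x := fun i => by
    have := e2 i; have := e5 i
    exact intg (by fun_prop) hHc (fun x hx => by simp [pd_zero hx])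
  have A4 : ∀ i, Integrable fun x => (ψ x * pd i (pd i v) x + pd i v x * pd i ψ x) * H x :=
    fun i => by
    have := e2 i; have := e4 i; have := e6 i
    exact intg (by fun_prop) hHc (fun x hx => by simp [k_zero hx])
  have A12 : Integrable fun x => (pd 0 ψ x * (v x * pd 0 H x + H x * pd 0 v x)
      + pd 1 ψ x * (v x * pd 1 H x + H x * pd 1 v x))
      + pd 1 (fun x => v x * (u x * u x)) x * (v x * H x) := ((A1 0).add (A1 1)).add A2
  have A01 : Integrable fun x => pd 0 ψ x * (v x * pd 0 H x + H x * pd 0 v x)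
      + pd 1 ψ x * (v x * pd 1 H x + H x * pd 1 v x) := (A1 0).add (A1 1)
  obtain ⟨A34, A34e⟩ := int4 (A3 0) (A3 1) (A4 0) (A4 1)
  have Z : 0 = ∫ x, (((pd 0 ψ x * (v x * pd 0 H x + H x * pd 0 v x)
      + pd 1 ψ x * (v x * pd 1 H x + H x * pd 1 v x))
      + pd 1 (fun x => v x * (u x * u x)) x * (v x * H x)) -
      ((ψ x * pd 0 v x * pd 0 H x + ψ x * pd 1 v x * pd 1 H x)
       + ((ψ x * pd 0 (pd 0 v) x + pd 0 v x * pd 0 ψ x) * H x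
        + (ψ x * pd 1 (pd 1 v) x + pd 1 v x * pd 1 ψ x) * H x))) := by
    rw [integral_sub A12 A34, A34e, integral_add A01 A2, integral_add (A1 0) (A1 1), W, B 0, B 1]
    ring
  have e10 := e1 0
  have e11 := e1 1
  have e31 := e3 1
  have I1 : Integrable fun x => 2 * u x * v x ^ 2 * pd 1 u x * g (τ x) * η x ^ 2 :=
    intg (by fun_prop) hc (fun x hx => by simp [k_zero hx])
  have I2 : Integrable fun x => ψ x ^ 2 * (pd 0 η x ^ 2 + pd 1 η x ^ 2) :=
    intg (by fun_prop) hc (fun x hx => by simp [pd_zero hx])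
  have hle : ∫ x, (2 * u x * v x ^ 2 * pd 1 u x * g (τ x) * η x ^ 2
      - ψ x ^ 2 * (pd 0 η x ^ 2 + pd 1 η x ^ 2)) ≤ 0 := by
    rw [Z]
    refine integral_mono (I1.sub I2) (A12.sub A34) fun x => ?_
    have hl := heqv x
    rw [lapl_eq] at hl
    have q0 := mul_nonneg (sq_nonneg (v x)) (quad (pd 0 τ x) (pd 0 η x) (η x) (τ x))
    have q1 := mul_nonneg (sq_nonneg (v x)) (quad (pd 1 τ x) (pd 1 η x) (η x) (τ x))
    have hψx : ψ x = τ x * v x := congrFun hψτ x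
    have hl2 : pd 1 (pd 1 v) x = v x * u x ^ 2 - pd 0 (pd 0 v) x := by linarith
    have hHx : H x = η x * (η x * g (τ x)) := congrFun hHdef x
    simp only [df, dψ, dH, hHx, hl2]
    simp only [hψx]
    rw [← sub_nonneg]
    refine (add_nonneg q0 q1).trans (le_of_eq ?_)
    ring
  rw [integral_sub I1 I2] at hle
  have hτx : ∀ x, ψ x / v x = τ x := fun x => (congrFun hτdef x).symm
  simp only [hτx]
  linarith

lemma key2 {u v : E2 → ℝ} (hu : ContDiff ℝ 2 u) (hv : ContDiff ℝ 2 v)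
    (heqv : ∀ x, lapl v x = v x * (u x) ^ 2) (hupos : ∀ x, 0 < u x) (hvpos : ∀ x, 0 < v x)
    (hmon : ∀ x, 0 < pd 1 u x) (hle : ∀ x, pd 1 v x ≤ 0) (x₀ : E2) : pd 1 v x₀ < 0 := by
  refine lt_of_le_of_ne (hle x₀) fun h0 => ?_
  have hv1 : ContDiff ℝ 1 v := hv.of_le (by norm_num)
  have hu1 : ContDiff ℝ 1 u := hu.of_le (by norm_num)
  have hψ := pd_contDiff hv 1
  set ψ := pd 1 v with hψdef
  have hf : ContDiff ℝ 1 (fun x => v x * (u x * u x)) := hv1.mul (hu1.mul hu1)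
  have df : ∀ x, pd 1 (fun x => v x * (u x * u x)) x
      = v x * (2 * u x * pd 1 u x) + u x ^ 2 * ψ x := by
    intro x
    rw [pd_mul hv1 (hu1.mul hu1), pd_mul hu1 hu1]
    ring
  have cf := pd_cont hf 1
  set F := pd 1 (fun x => v x * (u x * u x)) with hF
  have hF0 : 0 < F x₀ := by
    rw [df, h0]
    have := hupos x₀; have := hvpos x₀; have := hmon x₀
    positivity
  obtain ⟨c, hcdef⟩ : ∃ c, c = F x₀ / 8 := ⟨_, rfl⟩
  have hc : 0 < c := by rw [hcdef]; positivity
  have hev : ∀ᶠ x in 𝓝 x₀, 4 * c < F x :=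
    cf.continuousAt.eventually_const_lt (by rw [hcdef]; linarith)
  obtain ⟨r, hr, hball⟩ := Metric.eventually_nhds_iff.1 hev
  -- the paraboloid
  obtain ⟨N, hN⟩ : ∃ N : E2 → ℝ, N = fun x => (x 0 - x₀ 0) * (x 0 - x₀ 0)
    + (x 1 - x₀ 1) * (x 1 - x₀ 1) := ⟨_, rfl⟩
  have hlin : ∀ i : Fin 2, ContDiff ℝ 1 (fun x : E2 => x i - x₀ i) := fun i => by fun_prop
  have dlin : ∀ (i j : Fin 2) x, pd i (fun x : E2 => x j - x₀ j) x = if j = i then 1 else 0 := by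
    intro i j x
    unfold pd
    have h : HasFDerivAt (fun x : E2 => x j - x₀ j) (EuclideanSpace.proj j : E2 →L[ℝ] ℝ) x :=
      ((EuclideanSpace.proj j : E2 →L[ℝ] ℝ).hasFDerivAt).sub_const _
    rw [h.fderiv]; simp
  have hNc : ContDiff ℝ 1 N := by
    rw [hN]; exact ((hlin 0).mul (hlin 0)).add ((hlin 1).mul (hlin 1))
  have dN : ∀ i x, pd i N x = 2 * (x i - x₀ i) := by
    intro i x
    rw [hN, pd_add ((hlin 0).mul (hlin 0)) ((hlin 1).mul (hlin 1)), pd_mul (hlin 0) (hlin 0),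
      pd_mul (hlin 1) (hlin 1)]
    simp only [dlin]
    fin_cases i <;> simp <;> ring
  have hNd : ∀ x, N x = dist x x₀ ^ 2 := by
    intro x
    rw [hN, EuclideanSpace.dist_eq, Real.sq_sqrt (by positivity), Fin.sum_univ_two,
      Real.dist_eq, Real.dist_eq, sq_abs, sq_abs]
    ring
  obtain ⟨p, hp⟩ : ∃ p : E2 → ℝ, p = fun x => ψ x + ((-c) * N x + c * r ^ 2) := ⟨_, rfl⟩
  have hcN : ContDiff ℝ 1 (fun x => (-c) * N x) := contDiff_const.mul hNc
  have hcN2 : ContDiff ℝ 1 (fun x => (-c) * N x + c * r ^ 2) := hcN.add contDiff_const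
  have hpc : ContDiff ℝ 1 p := by rw [hp]; exact hψ.add hcN2
  have pdc : ∀ (a : ℝ) i x, pd i (fun _ => a) x = 0 := by
    intro a i x; simp [pd]
  have dp : ∀ i x, pd i ψ x = pd i p x + 2 * c * (x i - x₀ i) := by
    intro i x
    rw [hp, pd_add hψ hcN2, pd_add hcN contDiff_const, pd_mul contDiff_const hNc, pdc, pdc, dN]
    ring
  have hpp : ∀ x, 0 < p x → dist x x₀ < r := by
    intro x hx
    rw [hp] at hx
    simp only [hNd] at hx
    have := hle x
    have h2 : c * dist x x₀ ^ 2 < c * r ^ 2 := by linarith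
    exact lt_of_pow_lt_pow_left₀ 2 hr.le (lt_of_mul_lt_mul_left h2 hc.le)
  obtain ⟨ζ, hζdef⟩ : ∃ ζ : E2 → ℝ, ζ = fun x => q (p x) := ⟨_, rfl⟩
  have hζ : ContDiff ℝ 1 ζ := by rw [hζdef]; exact q_contDiff.comp hpc
  have dζ : ∀ i x, pd i ζ x = 2 * max (p x) 0 * pd i p x := by
    intro i x; rw [hζdef]; exact pd_comp hpc (q_deriv _) i
  have hζc : HasCompactSupport ζ := by
    apply HasCompactSupport.intro (isCompact_closedBall x₀ r)
    intro x hx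
    have : ¬ 0 < p x := fun h => hx (Metric.mem_closedBall.2 (hpp x h).le)
    rw [hζdef]; simp [q, max_eq_right (not_lt.1 this)]
  have W := weak_eq hv hf (fun x => by rw [heqv x]; ring) hζ hζc
  rw [← hψdef, ← hF] at W
  have B : ∀ i, ∫ x : E2, (x i - x₀ i) * pd i ζ x = - ∫ x, ζ x := by
    intro i
    rw [ibp (hlin i) hζ hζc i]
    simp [dlin]
  have c1 := hζ.continuous
  have c2 := fun i => pd_cont hζ i
  have c3 := fun i => pd_cont hψ i
  have c4 := fun i => pd_cont hpc i
  have J1 : ∀ i, Integrable fun x => pd i ψ x * pd i ζ x := fun i => by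
    have := c2 i; have := c3 i
    exact intg (by fun_prop) hζc (fun x hx => by simp [pd_zero hx])
  have J2 : ∀ i, Integrable fun x : E2 => 2 * c * ((x i - x₀ i) * pd i ζ x) := fun i => by
    have := c2 i
    exact intg (by fun_prop) hζc (fun x hx => by simp [pd_zero hx])
  have J3 : ∀ i, ∫ x, pd i p x * pd i ζ x = (∫ x, pd i ψ x * pd i ζ x) + 2 * c * ∫ x, ζ x := by
    intro i
    have : ∀ x, pd i p x * pd i ζ x = pd i ψ x * pd i ζ x - 2 * c * ((x i - x₀ i) * pd i ζ x) := by
      intro x; rw [dp]; ring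
    simp only [this]
    rw [integral_sub (J1 i) (J2 i), integral_const_mul, B]
    ring
  have J4 : ∀ i, 0 ≤ ∫ x, pd i p x * pd i ζ x := by
    intro i
    apply integral_nonneg
    intro x
    have : 0 ≤ max (p x) 0 := le_max_right _ _
    simp only [dζ, Pi.zero_apply]
    nlinarith [mul_nonneg this (sq_nonneg (pd i p x))]
  have hpos : 0 < ∫ x, (F x - 4 * c) * ζ x := by
    refine Continuous.integral_pos_of_hasCompactSupport_nonneg_nonzero (x := x₀)
      (by fun_prop) hζc.mul_left ?_ ?_
    · intro x
      by_cases h : 0 < p x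
      · exact mul_nonneg (sub_nonneg.2 (hball (hpp x h)).le) (by rw [hζdef]; exact sq_nonneg _)
      · simp [hζdef, q, max_eq_right (not_lt.1 h)]
    · have h1 : p x₀ = c * r ^ 2 := by rw [hp]; simp [h0, hNd]
      have h2 : 0 < p x₀ := by rw [h1]; positivity
      apply mul_ne_zero
      · have := hball (show dist x₀ x₀ < r by simpa using hr)
        linarith
      · simp only [hζdef, q, max_eq_left h2.le]; positivity
  have K1 : Integrable fun x => F x * ζ x :=
    intg (by fun_prop) hζc (fun x hx => by simp [k_zero hx])
  have K2 : Integrable fun x => 4 * c * ζ x :=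
    intg (by fun_prop) hζc (fun x hx => by simp [k_zero hx])
  simp only [sub_mul] at hpos
  rw [integral_sub K1 K2, integral_const_mul] at hpos
  have a0 := J3 0
  have a1 := J3 1
  have b0 := J4 0
  have b1 := J4 1
  linarith

/-- The model bump, one on the unit ball, zero outside the ball of radius two. -/
noncomputable def bump : ContDiffBump (0 : E2) := ⟨1, 2, one_pos, one_lt_two⟩

/-- Rescaled cutoff. -/
noncomputable def cut (R : ℝ) (x : E2) : ℝ := bump (R⁻¹ • x)

lemma cut_contDiff (R : ℝ) : ContDiff ℝ 1 (cut R) := by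
  unfold cut
  exact bump.contDiff.comp (contDiff_const_smul _)

lemma cut_nonneg (R : ℝ) (x : E2) : 0 ≤ cut R x := bump.nonneg

lemma cut_le_one (R : ℝ) (x : E2) : cut R x ≤ 1 := bump.le_one

lemma norm_inv_smul {R : ℝ} (hR : 0 < R) (x : E2) : ‖R⁻¹ • x‖ = ‖x‖ / R := by
  rw [norm_smul, norm_inv, Real.norm_eq_abs, abs_of_pos hR]; field_simp

lemma cut_one {R : ℝ} (hR : 0 < R) {x : E2} (hx : ‖x‖ ≤ R) : cut R x = 1 := by
  apply bump.one_of_mem_closedBall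
  rw [mem_closedBall_zero_iff, norm_inv_smul hR]
  exact (div_le_one hR).2 hx

lemma cut_zero {R : ℝ} (hR : 0 < R) {x : E2} (hx : 2 * R ≤ ‖x‖) : cut R x = 0 := by
  apply bump.zero_of_le_dist
  rw [dist_zero_right, norm_inv_smul hR]
  exact (le_div_iff₀ hR).2 hx

lemma cut_comp {R : ℝ} (hR : 0 < R) : HasCompactSupport (cut R) := by
  apply HasCompactSupport.intro (isCompact_closedBall (0 : E2) (2 * R))
  intro x hx
  rw [mem_closedBall_zero_iff, not_le] at hx
  exact cut_zero hR hx.le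

lemma pd_cut (R : ℝ) (i : Fin 2) (x : E2) : pd i (cut R) x = R⁻¹ * pd i bump (R⁻¹ • x) := by
  unfold pd
  have h : HasFDerivAt (cut R) ((fderiv ℝ bump (R⁻¹ • x)).comp
      (R⁻¹ • ContinuousLinearMap.id ℝ E2)) x :=
    (diffAt bump.contDiff (R⁻¹ • x)).hasFDerivAt.comp x
      ((ContinuousLinearMap.id ℝ E2).hasFDerivAt.const_smul R⁻¹)
  rw [h.fderiv]; simp

lemma pd_cut_outer {R : ℝ} (hR : 0 < R) (i : Fin 2) {x : E2} (hx : 2 * R < ‖x‖) :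
    pd i (cut R) x = 0 := by
  have : cut R =ᶠ[𝓝 x] fun _ => 0 := by
    filter_upwards [(isOpen_lt continuous_const continuous_norm).mem_nhds hx] with y hy
    exact cut_zero hR (le_of_lt hy)
  unfold pd
  rw [this.fderiv_eq]; simp

lemma pd_cut_inner {R : ℝ} (hR : 0 < R) (i : Fin 2) {x : E2} (hx : ‖x‖ < R) :
    pd i (cut R) x = 0 := by
  have : cut R =ᶠ[𝓝 x] fun _ => 1 := by
    filter_upwards [(isOpen_lt continuous_norm continuous_const).mem_nhds hx] with y hy
    exact cut_one hR (le_of_lt hy)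
  unfold pd
  rw [this.fderiv_eq]; simp

lemma bump_bound : ∃ K : ℝ, 0 ≤ K ∧ ∀ x, pd 0 bump x ^ 2 + pd 1 bump x ^ 2 ≤ K := by
  have c0 := pd_cont bump.contDiff 0
  have c1 := pd_cont bump.contDiff 1
  obtain ⟨K, hK⟩ := (Continuous.bounded_above_of_compact_support
    (f := fun x => pd 0 bump x ^ 2 + pd 1 bump x ^ 2) (by fun_prop)
    (HasCompactSupport.intro bump.hasCompactSupport (fun x hx => by simp [pd_zero hx])))
  refine ⟨K, (norm_nonneg _).trans (hK 0), fun x => (le_abs_self _).trans (hK x)⟩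

lemma cut_int {R : ℝ} (hR : 0 < R) : ∫ x, cut R x = R ^ 2 * ∫ x, bump x := by
  unfold cut
  rw [Measure.integral_comp_inv_smul volume (fun x => bump x) R]
  simp

lemma energy {v : E2 → ℝ} (hv : ContDiff ℝ 2 v) (hpos : ∀ x, 0 ≤ v x * lapl v x)
    (hv0 : ∀ x, 0 < v x) {C : ℝ} (hC : 0 < C) (hgr : ∀ x, v x ≤ C * (1 + ‖x‖)) :
    ∃ A : ℝ, 0 ≤ A ∧ ∀ R, 1 ≤ R →
      ∫ x, pd 1 v x ^ 2 * (pd 0 (cut R) x ^ 2 + pd 1 (cut R) x ^ 2) ≤ A := by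
  obtain ⟨K, hK0, hK⟩ := bump_bound
  have hv1 : ContDiff ℝ 1 v := hv.of_le (by norm_num)
  have hI : 0 ≤ ∫ x, bump x := integral_nonneg fun x => bump.nonneg
  refine ⟨400 * C ^ 2 * K ^ 2 * ∫ x, bump x, by positivity, fun R hR => ?_⟩
  have hR0 : 0 < R := by linarith
  have bd : ∀ S : ℝ, 0 < S → ∀ x, pd 0 (cut S) x ^ 2 + pd 1 (cut S) x ^ 2 ≤ K / S ^ 2 := by
    intro S hS x
    rw [pd_cut, pd_cut, mul_pow, mul_pow, ← mul_add, inv_pow, div_eq_inv_mul]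
    exact mul_le_mul_of_nonneg_left (hK _) (by positivity)
  have c0 := hv1.continuous
  have e0 := pd_cont hv1 0
  have e1 := pd_cont hv1 1
  have d := fun S i => pd_cont (cut_contDiff S) i
  have d10 := d R 0
  have d11 := d R 1
  have d20 := d (2 * R) 0
  have d21 := d (2 * R) 1
  have f2 := (cut_contDiff (2 * R)).continuous
  have f4 := (cut_contDiff (4 * R)).continuous
  have k1 := cut_comp hR0
  have k2 := cut_comp (show 0 < 2 * R by linarith)
  have k4 := cut_comp (show 0 < 4 * R by linarith)
  have s1 : ∫ x, pd 1 v x ^ 2 * (pd 0 (cut R) x ^ 2 + pd 1 (cut R) x ^ 2)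
      ≤ ∫ x, K / R ^ 2 * ((pd 0 v x ^ 2 + pd 1 v x ^ 2) * cut (2 * R) x ^ 2) := by
    apply integral_mono
    · exact intg (by fun_prop) k1 (fun x hx => by simp [pd_zero hx])
    · exact intg (by fun_prop) k2 (fun x hx => by simp [k_zero hx])
    intro x
    simp only
    rcases lt_or_ge (2 * R) ‖x‖ with h | h
    · rw [pd_cut_outer hR0 0 h, pd_cut_outer hR0 1 h]
      simp only [ne_eq, OfNat.ofNat_ne_zero, not_false_eq_true, zero_pow, add_zero, mul_zero]
      positivity
    · rw [cut_one (by linarith) h]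
      have := bd R hR0 x
      nlinarith [mul_le_mul_of_nonneg_left this (sq_nonneg (pd 1 v x)),
        mul_nonneg (show 0 ≤ K / R ^ 2 by positivity) (sq_nonneg (pd 0 v x))]
  have s2 := caccioppoli hv hpos (cut_contDiff (2 * R)) k2
  have s3 : ∫ x, v x ^ 2 * (pd 0 (cut (2 * R)) x ^ 2 + pd 1 (cut (2 * R)) x ^ 2)
      ≤ ∫ x, (25 * C ^ 2 * K / 4) * cut (4 * R) x := by
    apply integral_mono
    · exact intg (by fun_prop) k2 (fun x hx => by simp [pd_zero hx])
    · exact intg (by fun_prop) k4 (fun x hx => by simp [k_zero hx])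
    intro x
    simp only
    rcases lt_or_ge (2 * (2 * R)) ‖x‖ with h | h
    · rw [pd_cut_outer (by linarith) 0 h, pd_cut_outer (by linarith) 1 h]
      have := cut_nonneg (4 * R) x
      simp only [ne_eq, OfNat.ofNat_ne_zero, not_false_eq_true, zero_pow, add_zero, mul_zero]
      positivity
    · rw [cut_one (by linarith) (by linarith)]
      have h1 := bd (2 * R) (by linarith) x
      have h2 : v x ≤ C * (5 * R) :=
        (hgr x).trans (mul_le_mul_of_nonneg_left (by linarith) hC.le)
      have h3 : v x ^ 2 ≤ (C * (5 * R)) ^ 2 := pow_le_pow_left₀ (hv0 x).le h2 2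
      calc _ ≤ (C * (5 * R)) ^ 2 * (K / (2 * R) ^ 2) :=
            mul_le_mul h3 h1 (by positivity) (by positivity)
        _ = _ := by field_simp; ring
  rw [integral_const_mul] at s1 s3
  rw [cut_int (by linarith)] at s3
  calc _ ≤ _ := s1
    _ ≤ K / R ^ 2 * (4 * (25 * C ^ 2 * K / 4 * ((4 * R) ^ 2 * ∫ x, bump x))) := by
        apply mul_le_mul_of_nonneg_left _ (by positivity)
        linarith
    _ = _ := by field_simp; ring

lemma disj_sq {n : ℕ} (a : ℕ → ℝ) (h : ∀ i j, i < j → a i * a j = 0) :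
    (∑ k ∈ Finset.range n, a k) ^ 2 = ∑ k ∈ Finset.range n, a k ^ 2 := by
  induction n with
  | zero => simp
  | succ n ih =>
    rw [Finset.sum_range_succ, Finset.sum_range_succ, add_sq, ih]
    have : (∑ k ∈ Finset.range n, a k) * a n = 0 := by
      rw [Finset.sum_mul]
      exact Finset.sum_eq_zero fun k hk => h k n (Finset.mem_range.1 hk)
    rw [mul_assoc, this]; ring

/-- Averaged cutoff (a discrete logarithmic cutoff). -/
noncomputable def avg (R : ℝ) (n : ℕ) (x : E2) : ℝ :=
  (n : ℝ)⁻¹ * ∑ k ∈ Finset.range n, cut (R * 4 ^ k) x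

lemma avg_contDiff (R : ℝ) (n : ℕ) : ContDiff ℝ 1 (avg R n) := by
  unfold avg
  exact contDiff_const.mul (ContDiff.sum fun k _ => cut_contDiff _)

lemma pd_avg (R : ℝ) (n : ℕ) (i : Fin 2) (x : E2) :
    pd i (avg R n) x = (n : ℝ)⁻¹ * ∑ k ∈ Finset.range n, pd i (cut (R * 4 ^ k)) x := by
  have h : HasFDerivAt (avg R n)
      ((n : ℝ)⁻¹ • ∑ k ∈ Finset.range n, fderiv ℝ (cut (R * 4 ^ k)) x) x := by
    unfold avg
    apply HasFDerivAt.const_mul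
    apply HasFDerivAt.fun_sum
    intro k _
    exact (diffAt (cut_contDiff _) x).hasFDerivAt
  unfold pd
  rw [h.fderiv]; simp

lemma pd_avg_sq {R : ℝ} (hR : 0 < R) (n : ℕ) (i : Fin 2) (x : E2) :
    pd i (avg R n) x ^ 2
      = ((n : ℝ) ^ 2)⁻¹ * ∑ k ∈ Finset.range n, pd i (cut (R * 4 ^ k)) x ^ 2 := by
  rw [pd_avg, mul_pow, disj_sq, inv_pow]
  intro a b hab
  have hp : 2 * (R * 4 ^ a) < R * 4 ^ b := by
    have h1 : (4 : ℝ) ^ (a + 1) ≤ 4 ^ b := pow_le_pow_right₀ (by norm_num) hab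
    have h2 : (0 : ℝ) < 4 ^ a := by positivity
    rw [pow_succ] at h1
    nlinarith
  rcases lt_or_ge (2 * (R * 4 ^ a)) ‖x‖ with h | h
  · rw [pd_cut_outer (by positivity) i h, zero_mul]
  · rw [pd_cut_inner (R := R * 4 ^ b) (by positivity) i (by linarith), mul_zero]

lemma key3 {u v : E2 → ℝ} (hu : ContDiff ℝ 2 u) (hv : ContDiff ℝ 2 v)
    (heqv : ∀ x, lapl v x = v x * (u x) ^ 2) (hupos : ∀ x, 0 < u x) (hvpos : ∀ x, 0 < v x)
    (hmon : ∀ x, 0 < pd 1 u x) {C : ℝ} (hC : 0 < C) (hgr : ∀ x, v x ≤ C * (1 + ‖x‖))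
    (x₀ : E2) : pd 1 v x₀ ≤ 0 := by
  by_contra hcon
  rw [not_le] at hcon
  have hv1 : ContDiff ℝ 1 v := hv.of_le (by norm_num)
  have hu1 : ContDiff ℝ 1 u := hu.of_le (by norm_num)
  obtain ⟨A, hA0, hA⟩ := energy hv (fun x => by
    rw [heqv]; have := hvpos x; positivity) hvpos hC hgr
  obtain ⟨S, hS⟩ : ∃ S : ℝ, S = 1 + ‖x₀‖ := ⟨_, rfl⟩
  have hS1 : 1 ≤ S := by rw [hS]; linarith [norm_nonneg x₀]
  have hS0 : 0 < S := by linarith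
  obtain ⟨P, hP⟩ : ∃ P : E2 → ℝ, P = fun x => 2 * u x * v x ^ 2 * pd 1 u x * g (pd 1 v x / v x) :=
    ⟨_, rfl⟩
  have hP0 : ∀ x, 0 ≤ P x := by
    intro x; rw [hP]
    have := hupos x; have := hvpos x; have := hmon x; have := g_nonneg (pd 1 v x / v x)
    positivity
  have hPx : 0 < P x₀ := by
    rw [hP]
    have := hupos x₀; have := hvpos x₀; have := hmon x₀
    have := g_pos (div_pos hcon (hvpos x₀))
    positivity
  have cP : Continuous P := by
    have := hu1.continuous; have := hv1.continuous; have := pd_cont hu1 1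
    have : Continuous fun x => g (pd 1 v x / v x) :=
      g_contDiff.continuous.comp ((pd_cont hv1 1).div hv1.continuous fun x => (hvpos x).ne')
    rw [hP]; fun_prop
  have cS := (cut_contDiff S).continuous
  have hcS : HasCompactSupport fun x => P x * cut S x ^ 2 :=
    HasCompactSupport.intro (cut_comp hS0) (fun x hx => by simp [k_zero hx])
  have hpos : 0 < ∫ x, P x * cut S x ^ 2 := by
    refine Continuous.integral_pos_of_hasCompactSupport_nonneg_nonzero (x := x₀)
      (by fun_prop) hcS ?_ ?_
    · intro x; exact mul_nonneg (hP0 x) (sq_nonneg _)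
    · rw [cut_one hS0 (by rw [hS]; linarith)]
      simpa using hPx.ne'
  have hbd : ∀ n : ℕ, 0 < n → ∫ x, P x * cut S x ^ 2 ≤ A / n := by
    intro n hn
    have hnpos : (0 : ℝ) < n := by exact_mod_cast hn
    have hR : 0 < 2 * S := by linarith
    have hcomp : HasCompactSupport (avg (2 * S) n) := by
      apply HasCompactSupport.intro (isCompact_closedBall (0 : E2) (2 * (2 * S * 4 ^ n)))
      intro x hx
      rw [mem_closedBall_zero_iff, not_le] at hx
      unfold avg
      rw [Finset.sum_eq_zero, mul_zero]
      intro k hk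
      apply cut_zero (by positivity)
      have h1 : (4 : ℝ) ^ k ≤ 4 ^ n :=
        pow_le_pow_right₀ (by norm_num) (Finset.mem_range.1 hk).le
      have : 2 * S * 4 ^ k ≤ 2 * S * 4 ^ n := mul_le_mul_of_nonneg_left h1 hR.le
      linarith
    have hge : ∀ x, cut S x ≤ avg (2 * S) n x := by
      intro x
      rcases le_or_gt (2 * S) ‖x‖ with h | h
      · rw [cut_zero hS0 h]
        unfold avg
        exact mul_nonneg (by positivity) (Finset.sum_nonneg fun k _ => cut_nonneg _ _)
      · have : avg (2 * S) n x = 1 := by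
          unfold avg
          rw [Finset.sum_congr rfl (g := fun _ => (1 : ℝ))]
          · simp [hnpos.ne']
          · intro k _
            apply cut_one (by positivity)
            have : (1 : ℝ) ≤ 4 ^ k := one_le_pow₀ (by norm_num)
            nlinarith
        rw [this]; exact cut_le_one _ _
    have cA := (avg_contDiff (2 * S) n).continuous
    have m1 : ∫ x, P x * cut S x ^ 2 ≤ ∫ x, P x * avg (2 * S) n x ^ 2 := by
      apply integral_mono
      · exact intg (by fun_prop) (cut_comp hS0) (fun x hx => by simp [k_zero hx])
      · exact intg (by fun_prop) hcomp (fun x hx => by simp [k_zero hx])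
      intro x
      exact mul_le_mul_of_nonneg_left (pow_le_pow_left₀ (cut_nonneg _ _) (hge x) 2) (hP0 x)
    have m2 := key1 hu hv heqv hvpos (avg_contDiff (2 * S) n) hcomp
    have m3 : ∫ x, pd 1 v x ^ 2 * (pd 0 (avg (2 * S) n) x ^ 2 + pd 1 (avg (2 * S) n) x ^ 2)
        = ((n : ℝ) ^ 2)⁻¹ * ∑ k ∈ Finset.range n, ∫ x, pd 1 v x ^ 2 *
          (pd 0 (cut (2 * S * 4 ^ k)) x ^ 2 + pd 1 (cut (2 * S * 4 ^ k)) x ^ 2) := by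
      rw [← integral_finsetSum, ← integral_const_mul]
      · congr 1; ext x
        rw [pd_avg_sq hR, pd_avg_sq hR, ← mul_add, ← Finset.sum_add_distrib, ← Finset.mul_sum]
        ring
      · intro k _
        have := pd_cont (cut_contDiff (2 * S * 4 ^ k)) 0
        have := pd_cont (cut_contDiff (2 * S * 4 ^ k)) 1
        have := pd_cont hv1 1
        exact intg (by fun_prop) (cut_comp (show 0 < 2 * S * 4 ^ k by positivity))
          (fun x hx => by simp [pd_zero hx])
    have m4 : ∑ k ∈ Finset.range n, ∫ x, pd 1 v x ^ 2 *
          (pd 0 (cut (2 * S * 4 ^ k)) x ^ 2 + pd 1 (cut (2 * S * 4 ^ k)) x ^ 2) ≤ n * A := by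
      refine (Finset.sum_le_card_nsmul _ _ A fun k _ => hA _ ?_).trans (by simp)
      have : (1 : ℝ) ≤ 4 ^ k := one_le_pow₀ (by norm_num)
      nlinarith
    rw [hP] at m1 ⊢
    refine m1.trans (m2.trans ?_)
    rw [m3]
    calc _ ≤ ((n : ℝ) ^ 2)⁻¹ * (n * A) := mul_le_mul_of_nonneg_left m4 (by positivity)
      _ = _ := by field_simp
  obtain ⟨n, hn⟩ := exists_nat_gt (A / ∫ x, P x * cut S x ^ 2)
  have hn0 : (0 : ℝ) < n := lt_of_le_of_lt (by positivity) hn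
  have h1 := hbd n (by exact_mod_cast hn0)
  rw [le_div_iff₀ hn0] at h1
  rw [div_lt_iff₀ hpos] at hn
  linarith

end HalfMono

/-- **Theorem 4.1.** Let `(u, v)` be a solution of `Δu = u v²`, `Δv = v u²`,
`u, v > 0` on `ℝ²` with linear growth `u(x) + v(x) ≤ C (1 + |x|)` and such that
`∂u/∂x₂ > 0` everywhere. Then `∂v/∂x₂ < 0` everywhere. -/
theorem half_monotone_linear_growth_other_component_monotone
    (u v : EuclideanSpace ℝ (Fin 2) → ℝ)
    (hu : ContDiff ℝ 2 u) (hv : ContDiff ℝ 2 v)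
    (hequ : ∀ x, lapl u x = u x * (v x) ^ 2)
    (heqv : ∀ x, lapl v x = v x * (u x) ^ 2)
    (hupos : ∀ x, 0 < u x) (hvpos : ∀ x, 0 < v x)
    (C : ℝ) (hC : 0 < C)
    (hgrowth : ∀ x, u x + v x ≤ C * (1 + ‖x‖))
    (hmonu : ∀ x, 0 < fderiv ℝ u x (EuclideanSpace.single 1 1)) :
    ∀ x, fderiv ℝ v x (EuclideanSpace.single 1 1) < 0 := by

  have hgr : ∀ x, v x ≤ C * (1 + ‖x‖) := fun x => by linarith [hgrowth x, hupos x]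
  exact HalfMono.key2 hu hv heqv hupos hvpos hmonu
    (HalfMono.key3 hu hv heqv hupos hvpos hmonu hC hgr)
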